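/- Half relation: for all integers m, n ≥ 0 and every f ∈ 𝒫_Y, Θ_Z̃( Z̃_+Λ_Z̃^{m+1}( Ỹ_+Λ_Ỹ^{n}( z_0·f ) ) − Ỹ_+Λ_Ỹ^{n}( Z̃_+Λ_Z̃^{m+1}( z_0·f ) ) ) = Θ_Z̃( Z̃_+Λ_Z̃^{m+1}( z_0·( Y_+Λ_Y^{n} f ) ) ) − Y_+Λ_Y^{n}( Θ_Z̃( Z̃_+Λ_Z̃^{m+1}( z_0·f ) ) ); in operator form, Θ_Z̃ ∘ [Z̃_+Λ_Z̃^{m+1}, Ỹ_+Λ_Ỹ^{n}] ∘ (z_0·) = [Θ_Z̃ Z̃_+Λ_Z̃^{m+1} (z_0·), Y_+Λ_Y^{n}] on 𝒫_Y. -/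

import Mathlib

open MvPolynomial

noncomputable section

/-- The base field `K = ℚ(b)`: rational functions in an indeterminate `b` over `ℚ`. -/
abbrev K : Type := RatFunc ℚ

/-- The indeterminate `b ∈ K`. -/
def bb : K := RatFunc.X

/-- `α = 1 + b`. -/
def alpha : K := 1 + bb

/-- Variables: `p i` (used for `i ≥ 1`) and `y i`, `y' i`, `z i`, `z' i` (`i ≥ 0`). -/
inductive Var : Type
  | p : ℕ → Var
  | y : ℕ → Var
  | y' : ℕ → Var
  | z : ℕ → Var
  | z' : ℕ → Var
  deriving DecidableEq

/-- The ambient polynomial ring `R′`. -/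
abbrev R : Type := MvPolynomial Var K

/-- The generic operator
`Λ_A = α Σ_{i,j≥1} i a_{i+j−1} ∂²/∂p_i∂a_{j−1} + Σ_{i,j≥1} a_{i−1} p_j ∂/∂a_{i+j−1}
     + b Σ_{i≥1} i a_i ∂/∂a_i` for the alphabet `a ∈ {y, y′, z, z′}`. -/
def Lam (a : ℕ → Var) (f : R) : R :=
  alpha • (∑ᶠ (i : ℕ) (j : ℕ), ((i + 1 : ℕ) : K) •
      (X (a (i + j + 1)) * pderiv (Var.p (i + 1)) (pderiv (a j) f)))
    + (∑ᶠ (i : ℕ) (j : ℕ), X (a i) * X (Var.p (j + 1)) * pderiv (a (i + j + 1)) f)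
    + bb • (∑ᶠ (i : ℕ), ((i + 1 : ℕ) : K) • (X (a (i + 1)) * pderiv (a (i + 1)) f))

/-- The generic shift operator `A_+ = Σ_{i≥0} a_{i+1} ∂/∂a_i`. -/
def Plus (a : ℕ → Var) (f : R) : R := ∑ᶠ (i : ℕ), X (a (i + 1)) * pderiv (a i) f

/-- The generic operator `Θ_A = Σ_{i≥1} p_i ∂/∂a_i`. -/
def Theta (a : ℕ → Var) (f : R) : R := ∑ᶠ (i : ℕ), X (Var.p (i + 1)) * pderiv (a (i + 1)) f

/-- `M_Z = α Σ_{i,j,k≥1} y′_{i+j−1} z′_{k−1} ∂²/∂y_{i+k−1}∂z_{j−1}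
         + Σ_{i,j,k≥1} y_{i+j−1} z_{k−1} ∂²/∂y′_{i+k−1}∂z′_{j−1}
         + b Σ_{i,j,k≥1} y′_{i+j−1} z′_{k−1} ∂²/∂y′_{i+k−1}∂z′_{j−1}`. -/
def MZ (f : R) : R :=
  alpha • (∑ᶠ (i : ℕ) (j : ℕ) (k : ℕ), X (Var.y' (i + j + 1)) * X (Var.z' k) *
      pderiv (Var.y (i + k + 1)) (pderiv (Var.z j) f))
    + (∑ᶠ (i : ℕ) (j : ℕ) (k : ℕ), X (Var.y (i + j + 1)) * X (Var.z k) *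
      pderiv (Var.y' (i + k + 1)) (pderiv (Var.z' j) f))
    + bb • (∑ᶠ (i : ℕ) (j : ℕ) (k : ℕ), X (Var.y' (i + j + 1)) * X (Var.z' k) *
      pderiv (Var.y' (i + k + 1)) (pderiv (Var.z' j) f))

/-- `M_Y`: obtained from `M_Z` by exchanging `y ↔ z` and `y′ ↔ z′` everywhere. -/
def MY (f : R) : R :=
  alpha • (∑ᶠ (i : ℕ) (j : ℕ) (k : ℕ), X (Var.z' (i + j + 1)) * X (Var.y' k) *
      pderiv (Var.z (i + k + 1)) (pderiv (Var.y j) f))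
    + (∑ᶠ (i : ℕ) (j : ℕ) (k : ℕ), X (Var.z (i + j + 1)) * X (Var.y k) *
      pderiv (Var.z' (i + k + 1)) (pderiv (Var.y' j) f))
    + bb • (∑ᶠ (i : ℕ) (j : ℕ) (k : ℕ), X (Var.z' (i + j + 1)) * X (Var.y' k) *
      pderiv (Var.z' (i + k + 1)) (pderiv (Var.y' j) f))

/-- `Λ_Ỹ = Λ_Y + Λ_{Y′} + M_Y`. -/
def LamYt (f : R) : R := Lam Var.y f + Lam Var.y' f + MY f

/-- `Λ_Z̃ = Λ_Z + Λ_{Z′} + M_Z`. -/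
def LamZt (f : R) : R := Lam Var.z f + Lam Var.z' f + MZ f

/-- `Ỹ_+ = Y_+ + Y′_+`. -/
def Ytplus (f : R) : R := Plus Var.y f + Plus Var.y' f

/-- `Z̃_+ = Z_+ + Z′_+`. -/
def Ztplus (f : R) : R := Plus Var.z f + Plus Var.z' f

/-- `Θ_Z̃ = ∂/∂z₀ + Σ_{i≥1} p_i ∂/∂z_i + Σ_{i,j≥0} y_{i+j} ∂²/∂y′_i∂z′_j`. -/
def ThZt (f : R) : R :=
  pderiv (Var.z 0) f + (∑ᶠ (i : ℕ), X (Var.p (i + 1)) * pderiv (Var.z (i + 1)) f)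
    + (∑ᶠ (i : ℕ) (j : ℕ), X (Var.y (i + j)) * pderiv (Var.y' i) (pderiv (Var.z' j) f))

/-- `Θ_Ỹ = ∂/∂y₀ + Σ_{i≥1} p_i ∂/∂y_i + Σ_{i,j≥0} z_{i+j} ∂²/∂z′_i∂y′_j`. -/
def ThYt (f : R) : R :=
  pderiv (Var.y 0) f + (∑ᶠ (i : ℕ), X (Var.p (i + 1)) * pderiv (Var.y (i + 1)) f)
    + (∑ᶠ (i : ℕ) (j : ℕ), X (Var.z (i + j)) * pderiv (Var.z' i) (pderiv (Var.y' j) f))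

/-- `Δ = α Σ_{i,j≥0} z′_i y′_j ∂²/∂y_i∂z_j + Σ_{i,j≥0} z_i y_j ∂²/∂y′_i∂z′_j
      + b Σ_{i,j≥0} z′_i y′_j ∂²/∂y′_i∂z′_j`. -/
def Delta (f : R) : R :=
  alpha • (∑ᶠ (i : ℕ) (j : ℕ), X (Var.z' i) * X (Var.y' j) *
      pderiv (Var.y i) (pderiv (Var.z j) f))
    + (∑ᶠ (i : ℕ) (j : ℕ), X (Var.z i) * X (Var.y j) *
      pderiv (Var.y' i) (pderiv (Var.z' j) f))
    + bb • (∑ᶠ (i : ℕ) (j : ℕ), X (Var.z' i) * X (Var.y' j) *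
      pderiv (Var.y' i) (pderiv (Var.z' j) f))

/-- `𝒫`: the subalgebra of polynomials in the `p`-variables only. -/
def Psub : Subalgebra K R := MvPolynomial.supported K (Set.range Var.p)

/-- `𝒫_Y`: the `K`-linear span of the monomials `p_λ` and `y_i·p_λ`. -/
def PY : Submodule K R :=
  Submodule.span K ((Psub : Set R) ∪
    {g : R | ∃ i : ℕ, ∃ f ∈ (Psub : Set R), g = X (Var.y i) * f})

/-- `𝒫_{Ỹ,Z̃}`: the `K`-linear span of the monomials
`p_λ, y_i·p_λ, z_j·p_λ, y_i·z_j·p_λ, y′_i·p_λ, z′_j·p_λ, y′_i·z′_j·p_λ`. -/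
def PYZt : Submodule K R :=
  Submodule.span K ((Psub : Set R) ∪
    {g : R | ∃ f ∈ (Psub : Set R),
      (∃ i : ℕ, g = X (Var.y i) * f) ∨ (∃ j : ℕ, g = X (Var.z j) * f) ∨
      (∃ i : ℕ, ∃ j : ℕ, g = X (Var.y i) * X (Var.z j) * f) ∨
      (∃ i : ℕ, g = X (Var.y' i) * f) ∨ (∃ j : ℕ, g = X (Var.z' j) * f) ∨
      (∃ i : ℕ, ∃ j : ℕ, g = X (Var.y' i) * X (Var.z' j) * f)})

/-- `Z̃_+ Λ_Z̃^m`. -/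
def ZL (m : ℕ) (f : R) : R := Ztplus (LamZt^[m] f)

/-- `Ỹ_+ Λ_Ỹ^n`. -/
def YL (n : ℕ) (f : R) : R := Ytplus (LamYt^[n] f)

/-- `Y_+ Λ_Y^n` (with the plain, non-tilde operators). -/
def YLplain (n : ℕ) (f : R) : R := Plus Var.y ((Lam Var.y)^[n] f)

lemma exists_pderiv_eq_zero {a : ℕ → Var} (ha : Function.Injective a) (f : R) :
    ∃ N, ∀ n, N ≤ n → pderiv (a n) f = 0 := by
  have hfin : (a ⁻¹' (f.vars : Set Var)).Finite := f.vars.finite_toSet.preimage ha.injOn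
  obtain ⟨N, hN⟩ := hfin.bddAbove
  refine ⟨N + 1, fun n hn => pderiv_eq_zero_of_notMem_vars fun h => ?_⟩
  have := hN (show n ∈ a ⁻¹' (f.vars : Set Var) from h)
  omega

lemma pderiv_comm' (u v : Var) (f : R) : pderiv u (pderiv v f) = pderiv v (pderiv u f) := by
  have h : ⁅pderiv (R := K) u, pderiv v⁆ = 0 := derivation_ext fun w => by
    classical
    rw [Derivation.commutator_apply]
    simp only [pderiv_X, Pi.single_apply, apply_ite, map_zero, Derivation.map_one_eq_zero]
    simp
  rw [← sub_eq_zero, ← Derivation.commutator_apply, h, Derivation.zero_apply]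

lemma finite_support_of_eventually_zero {F : ℕ → R} (h : ∃ N, ∀ n, N ≤ n → F n = 0) :
    (Function.support F).Finite := by
  obtain ⟨N, hN⟩ := h
  refine (Set.finite_lt_nat N).subset fun n hn => ?_
  by_contra hlt
  exact hn (hN n (not_lt.mp hlt))

lemma isLinearMap_finsum {T : ℕ → R → R} (hT : ∀ i, IsLinearMap K (T i))
    (hfin : ∀ f, ∃ N, ∀ n, N ≤ n → T n f = 0) : IsLinearMap K fun f => ∑ᶠ i, T i f where
  map_add f g := by
    simp only [(hT _).map_add]
    exact finsum_add_distrib (finite_support_of_eventually_zero (hfin f))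
      (finite_support_of_eventually_zero (hfin g))
  map_smul c f := by
    simp only [(hT _).map_smul]
    exact (smul_finsum c _).symm

lemma IsLinearMap.add_apply {S T : R → R} (hS : IsLinearMap K S) (hT : IsLinearMap K T) :
    IsLinearMap K fun f => S f + T f :=
  (hS.mk' S + hT.mk' T).isLinear

lemma IsLinearMap.smul_apply {T : R → R} (c : K) (hT : IsLinearMap K T) :
    IsLinearMap K fun f => c • T f :=
  (c • hT.mk' T).isLinear

lemma IsLinearMap.comp_apply {S T : R → R} (hS : IsLinearMap K S) (hT : IsLinearMap K T) :
    IsLinearMap K fun f => S (T f) :=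
  (hS.mk' S ∘ₗ hT.mk' T).isLinear

lemma isLinearMap_mul_pderiv (g : R) (u : Var) : IsLinearMap K fun f : R => g * pderiv u f :=
  (LinearMap.mulLeft K g ∘ₗ (pderiv (R := K) u).toLinearMap).isLinear

lemma isLinearMap_mul_pderiv_pderiv (g : R) (u v : Var) :
    IsLinearMap K fun f : R => g * pderiv u (pderiv v f) :=
  (LinearMap.mulLeft K g ∘ₗ (pderiv (R := K) u).toLinearMap ∘ₗ
    (pderiv (R := K) v).toLinearMap).isLinear

lemma isLinearMap_plus {a : ℕ → Var} (ha : Function.Injective a) :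
    IsLinearMap K (Plus a) := by
  refine isLinearMap_finsum (fun i => isLinearMap_mul_pderiv _ _) fun f => ?_
  obtain ⟨N, hN⟩ := exists_pderiv_eq_zero ha f
  exact ⟨N, fun n hn => by rw [hN n hn, mul_zero]⟩

lemma p_injective : Function.Injective Var.p := fun _ _ h => by injection h
lemma y_injective : Function.Injective Var.y := fun _ _ h => by injection h
lemma y'_injective : Function.Injective Var.y' := fun _ _ h => by injection h
lemma z_injective : Function.Injective Var.z := fun _ _ h => by injection h
lemma z'_injective : Function.Injective Var.z' := fun _ _ h => by injection h

lemma isLinearMap_lam {a : ℕ → Var} (ha : Function.Injective a) :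
    IsLinearMap K (Lam a) := by
  refine .add_apply (.add_apply (.smul_apply _ ?_) ?_) (.smul_apply _ ?_)
  · refine isLinearMap_finsum (fun i => isLinearMap_finsum
      (fun j => .smul_apply _ (isLinearMap_mul_pderiv_pderiv _ _ _)) fun f => ?_) fun f => ?_
    · obtain ⟨N, hN⟩ := exists_pderiv_eq_zero ha f
      exact ⟨N, fun n hn => by simp [hN n hn]⟩
    · obtain ⟨N, hN⟩ := exists_pderiv_eq_zero p_injective f
      exact ⟨N, fun n hn => by simp [pderiv_comm' (Var.p _), hN (n + 1) (by omega)]⟩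
  · refine isLinearMap_finsum (fun i => isLinearMap_finsum
      (fun j => isLinearMap_mul_pderiv _ _) fun f => ?_) fun f => ?_
    all_goals
      obtain ⟨N, hN⟩ := exists_pderiv_eq_zero ha f
      refine ⟨N, fun n hn => ?_⟩
    · rw [hN _ (by omega), mul_zero]
    · rw [← finsum_zero (α := ℕ)]
      exact finsum_congr fun j => by rw [hN _ (by omega), mul_zero]
  · refine isLinearMap_finsum (fun i => .smul_apply _ (isLinearMap_mul_pderiv _ _)) fun f => ?_
    obtain ⟨N, hN⟩ := exists_pderiv_eq_zero ha f
    exact ⟨N, fun n hn => by simp [hN (n + 1) (by omega)]⟩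

lemma isLinearMap_mixed {u v : ℕ → Var} (hu : Function.Injective u) (hv : Function.Injective v)
    (c d : ℕ → Var) :
    IsLinearMap K fun f : R => ∑ᶠ (i : ℕ) (j : ℕ) (k : ℕ), X (c (i + j + 1)) * X (d k) *
      pderiv (u (i + k + 1)) (pderiv (v j) f) := by
  refine isLinearMap_finsum (fun i => isLinearMap_finsum (fun j => isLinearMap_finsum
    (fun k => isLinearMap_mul_pderiv_pderiv _ _ _) fun f => ?_) fun f => ?_) fun f => ?_
  · obtain ⟨N, hN⟩ := exists_pderiv_eq_zero hu f
    exact ⟨N, fun n hn => by rw [pderiv_comm', hN _ (by omega), map_zero, mul_zero]⟩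
  · obtain ⟨N, hN⟩ := exists_pderiv_eq_zero hv f
    exact ⟨N, fun n hn => by simp [hN n hn]⟩
  · obtain ⟨N, hN⟩ := exists_pderiv_eq_zero hu f
    refine ⟨N, fun n hn => ?_⟩
    have h (j k : ℕ) : pderiv (u (n + k + 1)) (pderiv (v j) f) = 0 := by
      rw [pderiv_comm', hN _ (by omega), map_zero]
    simp [h]

lemma isLinearMap_MZ : IsLinearMap K MZ :=
  .add_apply (.add_apply (.smul_apply _ (isLinearMap_mixed y_injective z_injective _ _))
    (isLinearMap_mixed y'_injective z'_injective _ _))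
    (.smul_apply _ (isLinearMap_mixed y'_injective z'_injective _ _))

lemma isLinearMap_MY : IsLinearMap K MY :=
  .add_apply (.add_apply (.smul_apply _ (isLinearMap_mixed z_injective y_injective _ _))
    (isLinearMap_mixed z'_injective y'_injective _ _))
    (.smul_apply _ (isLinearMap_mixed z'_injective y'_injective _ _))

lemma isLinearMap_lamYt : IsLinearMap K LamYt :=
  .add_apply (.add_apply (isLinearMap_lam y_injective) (isLinearMap_lam y'_injective))
    isLinearMap_MY

lemma isLinearMap_lamZt : IsLinearMap K LamZt :=
  .add_apply (.add_apply (isLinearMap_lam z_injective) (isLinearMap_lam z'_injective))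
    isLinearMap_MZ

lemma isLinearMap_ytplus : IsLinearMap K Ytplus :=
  .add_apply (isLinearMap_plus y_injective) (isLinearMap_plus y'_injective)

lemma isLinearMap_ztplus : IsLinearMap K Ztplus :=
  .add_apply (isLinearMap_plus z_injective) (isLinearMap_plus z'_injective)

lemma isLinearMap_thZt : IsLinearMap K ThZt := by
  refine .add_apply (.add_apply (pderiv (R := K) (Var.z 0)).toLinearMap.isLinear
    (isLinearMap_finsum (fun i => isLinearMap_mul_pderiv _ _) fun f => ?_))
    (isLinearMap_finsum (fun i => isLinearMap_finsum
      (fun j => isLinearMap_mul_pderiv_pderiv _ _ _) fun f => ?_) fun f => ?_)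
  · obtain ⟨N, hN⟩ := exists_pderiv_eq_zero z_injective f
    exact ⟨N, fun n hn => by rw [hN _ (by omega), mul_zero]⟩
  · obtain ⟨N, hN⟩ := exists_pderiv_eq_zero z'_injective f
    exact ⟨N, fun n hn => by rw [hN _ hn, map_zero, mul_zero]⟩
  · obtain ⟨N, hN⟩ := exists_pderiv_eq_zero y'_injective f
    exact ⟨N, fun n hn => by simp [pderiv_comm' (Var.y' _), hN n hn]⟩

lemma finsum_mem' {S : Submodule K R} {F : ℕ → R} (h : ∀ i, F i ∈ S) : ∑ᶠ i, F i ∈ S :=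
  finsum_induction (· ∈ S) S.zero_mem (fun _ _ => S.add_mem) h

lemma lam_mem {S : Submodule K R} {a : ℕ → Var} {f : R}
    (h₁ : ∀ m i j, X (a m) * pderiv (Var.p i) (pderiv (a j) f) ∈ S)
    (h₂ : ∀ m i j, X (a m) * X (Var.p i) * pderiv (a j) f ∈ S)
    (h₃ : ∀ m j, X (a m) * pderiv (a j) f ∈ S) : Lam a f ∈ S :=
  S.add_mem (S.add_mem
    (S.smul_mem _ (finsum_mem' fun _ => finsum_mem' fun _ => S.smul_mem _ (h₁ _ _ _)))
    (finsum_mem' fun _ => finsum_mem' fun _ => h₂ _ _ _))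
    (S.smul_mem _ (finsum_mem' fun _ => S.smul_mem _ (h₃ _ _)))

lemma pderiv_X_of_ne' {v w : Var} (h : v ≠ w) : pderiv (R := K) v (X w) = 0 :=
  pderiv_X_of_ne h.symm

lemma pderiv_lam_eq_zero {a : ℕ → Var} {v : Var} (ha : ∀ n, v ≠ a n) (hp : ∀ n, v ≠ Var.p n)
    {f : R} (hf : pderiv v f = 0) : pderiv v (Lam a f) = 0 := by
  have key : Lam a f ∈ LinearMap.ker (pderiv (R := K) v).toLinearMap := by
    apply lam_mem <;> intros <;>
    simp [Derivation.leibniz, pderiv_X_of_ne' (ha _), pderiv_X_of_ne' (hp _),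
      pderiv_comm' v, hf]
  simpa using key

lemma lam_eq_zero {a : ℕ → Var} {f : R} (hf : ∀ n, pderiv (a n) f = 0) : Lam a f = 0 := by
  simp [Lam, hf]

lemma plus_eq_zero {a : ℕ → Var} {f : R} (hf : ∀ n, pderiv (a n) f = 0) : Plus a f = 0 := by
  simp [Plus, hf]

lemma lam_mul {a : ℕ → Var} {g : R} (hg : ∀ n, pderiv (a n) g = 0)
    (hp : ∀ n, pderiv (Var.p n) g = 0) (f : R) : Lam a (g * f) = g * Lam a f := by
  simp only [Lam, Derivation.leibniz, hg, hp, smul_eq_mul, mul_zero, add_zero, mul_add,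
    mul_smul_comm, mul_finsum]
  simp only [mul_left_comm g, mul_assoc]

lemma plus_mul {a : ℕ → Var} {g : R} (hg : ∀ n, pderiv (a n) g = 0) (f : R) :
    Plus a (g * f) = g * Plus a f := by
  simp only [Plus, Derivation.leibniz, hg, smul_eq_mul, mul_zero, add_zero, mul_finsum]
  simp only [mul_left_comm g]

/-- The operator `Σ c_{i+j−1} d_{k−1} ∂²/∂u_{i+k−1}∂v_{j−1}`, the building block of `MY`
and `MZ`. -/
def Mixed (u v c d : ℕ → Var) (f : R) : R :=
  ∑ᶠ (i : ℕ) (j : ℕ) (k : ℕ), X (c (i + j + 1)) * X (d k) *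
      pderiv (u (i + k + 1)) (pderiv (v j) f)

lemma MY_eq_mixed (f : R) : MY f = alpha • Mixed Var.z Var.y Var.z' Var.y' f
    + Mixed Var.z' Var.y' Var.z Var.y f + bb • Mixed Var.z' Var.y' Var.z' Var.y' f := rfl

lemma MZ_eq_mixed (f : R) : MZ f = alpha • Mixed Var.y Var.z Var.y' Var.z' f
    + Mixed Var.y' Var.z' Var.y Var.z f + bb • Mixed Var.y' Var.z' Var.y' Var.z' f := rfl

lemma mixed_eq_zero {u v c d : ℕ → Var} {f : R}
    (h : ∀ i j, pderiv (u (i + 1)) (pderiv (v j) f) = 0) : Mixed u v c d f = 0 := by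
  simp [Mixed, h]

lemma mixed_eq_zero_of_right {u v c d : ℕ → Var} {f : R}
    (h : ∀ j, pderiv (v j) f = 0) : Mixed u v c d f = 0 :=
  mixed_eq_zero fun _ _ => by rw [h, map_zero]

lemma mixed_eq_zero_of_left {u v c d : ℕ → Var} {f : R}
    (h : ∀ j, pderiv (u (j + 1)) f = 0) : Mixed u v c d f = 0 :=
  mixed_eq_zero fun _ _ => by rw [pderiv_comm', h, map_zero]

lemma finsum_ite_add (F : ℕ → ℕ → R) (t : ℕ) :
    ∑ᶠ (i : ℕ) (k : ℕ), (if i + k + 1 = t then F i k else 0)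
      = ∑ i ∈ Finset.range t, F i (t - 1 - i) := by
  have h (i : ℕ) : ∑ᶠ k : ℕ, (if i + k + 1 = t then F i k else 0)
      = if i < t then F i (t - 1 - i) else 0 := by
    rw [finsum_eq_single _ (t - 1 - i) fun k hk => if_neg (by omega)]
    exact if_congr (by omega) rfl rfl
  simp only [h]
  rw [finsum_eq_sum_of_support_subset (s := Finset.range t)]
  · exact Finset.sum_congr rfl fun i hi => if_pos (Finset.mem_range.mp hi)
  · intro i hi
    by_contra hlt
    exact hi (if_neg (by simpa using hlt))

lemma finsum_ite_eq (F : ℕ → R) (s : ℕ) : ∑ᶠ j, (if j = s then F j else 0) = F s := by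
  rw [finsum_eq_single _ s fun j hj => if_neg hj, if_pos rfl]

lemma pderiv_X_mul {a : ℕ → Var} (ha : Function.Injective a) {g : R}
    (hg : ∀ n, pderiv (a n) g = 0) (n s : ℕ) :
    pderiv (a n) (X (a s) * g) = if n = s then g else 0 := by
  classical
  simp [Derivation.leibniz, hg, pderiv_X, Pi.single_apply, ha.eq_iff, eq_comm]

lemma mixed_X_mul_X_mul {u v c d : ℕ → Var} (hu : Function.Injective u)
    (hv : Function.Injective v) (huv : ∀ i j, u i ≠ v j) {q : R}
    (hqu : ∀ n, pderiv (u n) q = 0) (hqv : ∀ n, pderiv (v n) q = 0) (s t : ℕ) :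
    Mixed u v c d (X (v s) * X (u t) * q)
      = ∑ i ∈ Finset.range t, X (c (i + s + 1)) * X (d (t - 1 - i)) * q := by
  have h (j : ℕ) : pderiv (v j) (X (v s) * (X (u t) * q)) = if j = s then X (u t) * q else 0 :=
    pderiv_X_mul hv (fun n => by
      simp [Derivation.leibniz, hqv, pderiv_X_of_ne' (huv t n).symm]) _ _
  have h' (i j k : ℕ) : pderiv (u (i + k + 1)) (pderiv (v j) (X (v s) * X (u t) * q))
      = if j = s then (if i + k + 1 = t then q else 0) else 0 := by
    rw [mul_assoc, h, apply_ite (pderiv _), map_zero, pderiv_X_mul hu hqu]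
  have h'' (i j : ℕ) : ∑ᶠ k : ℕ, X (c (i + j + 1)) * X (d k)
        * (if j = s then (if i + k + 1 = t then q else 0) else (0 : R))
      = if j = s then ∑ᶠ k : ℕ, (if i + k + 1 = t then X (c (i + j + 1)) * X (d k) * q else 0)
        else 0 := by
    split_ifs <;> simp
  simp only [Mixed, h', h'', finsum_ite_eq]
  exact finsum_ite_add (fun i k => X (c (i + s + 1)) * X (d k) * q) t

lemma plus_X_mul {a : ℕ → Var} (ha : Function.Injective a) {g : R}
    (hg : ∀ n, pderiv (a n) g = 0) (s : ℕ) :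
    Plus a (X (a s) * g) = X (a (s + 1)) * g := by
  simp only [Plus, pderiv_X_mul ha hg, mul_ite, mul_zero]
  exact finsum_ite_eq (fun i => X (a (i + 1)) * g) s

lemma lam_X_mul {a : ℕ → Var} (ha : Function.Injective a) {g : R}
    (hg : ∀ n, pderiv (a n) g = 0) (s : ℕ) :
    Lam a (X (a s) * g)
      = alpha • (∑ᶠ i : ℕ, ((i + 1 : ℕ) : K) • (X (a (i + s + 1)) * pderiv (Var.p (i + 1)) g))
        + (∑ k ∈ Finset.range s, X (a (s - 1 - k)) * X (Var.p (k + 1)) * g)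
        + bb • ((s : K) • (X (a s) * g)) := by
  simp only [Lam, pderiv_X_mul ha hg]
  congr 1
  · congr 1
    · congr 1
      refine finsum_congr fun i => ?_
      simp only [apply_ite (pderiv (R := K) _), map_zero, mul_ite, mul_zero, smul_ite, smul_zero]
      exact finsum_ite_eq
        (fun j => ((i + 1 : ℕ) : K) • (X (a (i + j + 1)) * pderiv (Var.p (i + 1)) g)) s
    · simp only [mul_ite, mul_zero]
      rw [finsum_ite_add (fun i j => X (a i) * X (Var.p (j + 1)) * g), ← Finset.sum_range_reflect]
      refine Finset.sum_congr rfl fun k hk => ?_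
      have := Finset.mem_range.mp hk
      rw [show s - 1 - (s - 1 - k) = k by omega]
  · congr 1
    cases s with
    | zero => simp
    | succ s =>
      simp only [mul_ite, mul_zero, smul_ite, smul_zero, add_left_inj]
      exact finsum_ite_eq (fun i => ((i + 1 : ℕ) : K) • (X (a (i + 1)) * g)) s

/-- A polynomial that is annihilated by all derivatives in the `y`, `y'`, `z`, `z'` variables. -/
structure IsCoeff (q : R) : Prop where
  y : ∀ n, pderiv (Var.y n) q = 0
  y' : ∀ n, pderiv (Var.y' n) q = 0
  z : ∀ n, pderiv (Var.z n) q = 0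
  z' : ∀ n, pderiv (Var.z' n) q = 0

lemma IsCoeff.of_mem_psub {q : R} (hq : q ∈ Psub) : IsCoeff q := by
  have h {v : Var} (hv : v ∉ Set.range Var.p) : pderiv v q = 0 :=
    pderiv_eq_zero_of_notMem_vars fun hmem => hv ((mem_supported.mp hq) hmem)
  constructor <;> exact fun n => h (by simp)

lemma IsCoeff.pderiv_p {q : R} (hq : IsCoeff q) (i : ℕ) : IsCoeff (pderiv (Var.p i) q) := by
  constructor <;> intro n <;> rw [pderiv_comm'] <;> simp [hq.y, hq.y', hq.z, hq.z']

lemma IsCoeff.p_mul {q : R} (hq : IsCoeff q) (i : ℕ) : IsCoeff (X (Var.p i) * q) := by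
  constructor <;> intro n <;>
    simp [Derivation.leibniz, hq.y, hq.y', hq.z, hq.z']

/-- The span of the elements `z_j q`, `y_i z_j q` and `y'_i z'_j q`. -/
def ZSpan : Submodule K R :=
  Submodule.span K {g : R | ∃ q, IsCoeff q ∧ ((∃ j, g = X (Var.z j) * q) ∨
    (∃ i j, g = X (Var.y i) * X (Var.z j) * q) ∨
    (∃ i j, g = X (Var.y' i) * X (Var.z' j) * q))}

lemma z_mem {g q : R} (hq : IsCoeff q) {j : ℕ} (h : g = X (Var.z j) * q) : g ∈ ZSpan :=
  Submodule.subset_span ⟨q, hq, .inl ⟨j, h⟩⟩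

lemma yz_mem {g q : R} (hq : IsCoeff q) {i j : ℕ} (h : g = X (Var.y i) * X (Var.z j) * q) :
    g ∈ ZSpan :=
  Submodule.subset_span ⟨q, hq, .inr (.inl ⟨i, j, h⟩)⟩

lemma y'z'_mem {g q : R} (hq : IsCoeff q) {i j : ℕ} (h : g = X (Var.y' i) * X (Var.z' j) * q) :
    g ∈ ZSpan :=
  Submodule.subset_span ⟨q, hq, .inr (.inr ⟨i, j, h⟩)⟩

lemma ZSpan.induction {P : R → Prop} (hz : ∀ j q, IsCoeff q → P (X (Var.z j) * q))
    (hyz : ∀ i j q, IsCoeff q → P (X (Var.y i) * X (Var.z j) * q))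
    (hyz' : ∀ i j q, IsCoeff q → P (X (Var.y' i) * X (Var.z' j) * q))
    (h0 : P 0) (hadd : ∀ f g, P f → P g → P (f + g)) (hsmul : ∀ (c : K) f, P f → P (c • f))
    {f : R} (hf : f ∈ ZSpan) : P f := by
  refine Submodule.span_induction ?_ h0 (fun f g _ _ => hadd f g) (fun c f _ => hsmul c f) hf
  rintro g ⟨q, hq, ⟨j, rfl⟩ | ⟨i, j, rfl⟩ | ⟨i, j, rfl⟩⟩
  exacts [hz j q hq, hyz i j q hq, hyz' i j q hq]

lemma ZSpan.map_mem {T : R → R} (hT : IsLinearMap K T)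
    (hz : ∀ j q, IsCoeff q → T (X (Var.z j) * q) ∈ ZSpan)
    (hyz : ∀ i j q, IsCoeff q → T (X (Var.y i) * X (Var.z j) * q) ∈ ZSpan)
    (hyz' : ∀ i j q, IsCoeff q → T (X (Var.y' i) * X (Var.z' j) * q) ∈ ZSpan)
    {f : R} (hf : f ∈ ZSpan) : T f ∈ ZSpan :=
  ZSpan.induction (P := fun f => T f ∈ ZSpan) hz hyz hyz'
    (by rw [hT.map_zero]; exact ZSpan.zero_mem)
    (fun f g hf hg => by rw [hT.map_add]; exact ZSpan.add_mem hf hg)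
    (fun c f hf => by rw [hT.map_smul]; exact ZSpan.smul_mem c hf) hf

lemma ZSpan.eq_on {S T : R → R} (hS : IsLinearMap K S) (hT : IsLinearMap K T)
    (hz : ∀ j q, IsCoeff q → S (X (Var.z j) * q) = T (X (Var.z j) * q))
    (hyz : ∀ i j q, IsCoeff q →
      S (X (Var.y i) * X (Var.z j) * q) = T (X (Var.y i) * X (Var.z j) * q))
    (hyz' : ∀ i j q, IsCoeff q →
      S (X (Var.y' i) * X (Var.z' j) * q) = T (X (Var.y' i) * X (Var.z' j) * q))
    {f : R} (hf : f ∈ ZSpan) : S f = T f :=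
  ZSpan.induction (P := fun f => S f = T f) hz hyz hyz'
    (by rw [hS.map_zero, hT.map_zero])
    (fun f g hf hg => by rw [hS.map_add, hT.map_add, hf, hg])
    (fun c f hf => by rw [hS.map_smul, hT.map_smul, hf]) hf

lemma lam_X_mul_mem {S : Submodule K R} {a : ℕ → Var} (ha : Function.Injective a) {g : R}
    (hg : ∀ n, pderiv (a n) g = 0) (s : ℕ)
    (h₁ : ∀ m i, X (a m) * pderiv (Var.p i) g ∈ S)
    (h₂ : ∀ m i, X (a m) * X (Var.p i) * g ∈ S)
    (h₃ : ∀ m, X (a m) * g ∈ S) : Lam a (X (a s) * g) ∈ S := by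
  rw [lam_X_mul ha hg]
  exact S.add_mem (S.add_mem
    (S.smul_mem _ (finsum_mem' fun _ => S.smul_mem _ (h₁ _ _)))
    (S.sum_mem fun _ _ => h₂ _ _)) (S.smul_mem _ (S.smul_mem _ (h₃ _)))

lemma mixed_mem {S : Submodule K R} {u v c d : ℕ → Var} (hu : Function.Injective u)
    (hv : Function.Injective v) (huv : ∀ i j, u i ≠ v j) {q : R}
    (hqu : ∀ n, pderiv (u n) q = 0) (hqv : ∀ n, pderiv (v n) q = 0) (s t : ℕ)
    (h : ∀ i k, X (c i) * X (d k) * q ∈ S) :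
    Mixed u v c d (X (v s) * X (u t) * q) ∈ S := by
  rw [mixed_X_mul_X_mul hu hv huv hqu hqv]
  exact S.sum_mem fun _ _ => h _ _

lemma lamZt_mem {f : R} (hf : f ∈ ZSpan) : LamZt f ∈ ZSpan := by
  refine ZSpan.map_mem isLinearMap_lamZt (fun j q hq => ?_) (fun i j q hq => ?_)
    (fun i j q hq => ?_) hf
  · have h1 : Lam Var.z' (X (Var.z j) * q) = 0 := lam_eq_zero fun n => by
      simp [Derivation.leibniz, hq.z']
    have h2 : MZ (X (Var.z j) * q) = 0 := by
      rw [MZ_eq_mixed, mixed_eq_zero_of_left, mixed_eq_zero_of_left, mixed_eq_zero_of_left]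
      · simp
      all_goals intro n; simp [Derivation.leibniz, hq.y, hq.y']
    rw [LamZt, h1, h2, add_zero, add_zero]
    exact lam_X_mul_mem z_injective hq.z j (fun m i => z_mem (hq.pderiv_p i) rfl)
      (fun m i => z_mem (hq.p_mul i) (mul_assoc _ _ _)) (fun m => z_mem hq rfl)
  · have h1 : Lam Var.z' (X (Var.y i) * X (Var.z j) * q) = 0 := lam_eq_zero fun n => by
      simp [Derivation.leibniz, hq.z']
    have h2 : Mixed Var.y' Var.z' Var.y Var.z (X (Var.y i) * X (Var.z j) * q) = 0 :=
      mixed_eq_zero_of_left fun n => by simp [Derivation.leibniz, hq.y']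
    have h3 : Mixed Var.y' Var.z' Var.y' Var.z' (X (Var.y i) * X (Var.z j) * q) = 0 :=
      mixed_eq_zero_of_left fun n => by simp [Derivation.leibniz, hq.y']
    rw [LamZt, h1, MZ_eq_mixed, h2, h3, mul_comm (X (Var.y i)) (X (Var.z j)), smul_zero, add_zero,
      add_zero, add_zero]
    refine ZSpan.add_mem ?_ (ZSpan.smul_mem _ (mixed_mem y_injective z_injective (by simp)
      hq.y hq.z _ _ fun _ _ => y'z'_mem hq rfl))
    rw [mul_assoc]
    refine lam_X_mul_mem z_injective
      (fun n => by simp [Derivation.leibniz, hq.z]) j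
      (fun m k => yz_mem (i := i) (j := m) (hq.pderiv_p k) ?_) (fun m k => yz_mem (i := i) (j := m) (hq.p_mul k) ?_)
      (fun m => yz_mem (i := i) (j := m) hq ?_)
    · simp only [Derivation.leibniz, smul_eq_mul]; simp; ring
    all_goals ring
  · have h1 : Lam Var.z (X (Var.y' i) * X (Var.z' j) * q) = 0 := lam_eq_zero fun n => by
      simp [Derivation.leibniz, hq.z]
    have h2 : Mixed Var.y Var.z Var.y' Var.z' (X (Var.y' i) * X (Var.z' j) * q) = 0 :=
      mixed_eq_zero_of_left fun n => by simp [Derivation.leibniz, hq.y]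
    rw [LamZt, h1, MZ_eq_mixed, h2, mul_comm (X (Var.y' i)) (X (Var.z' j)), smul_zero, zero_add,
      zero_add]
    refine ZSpan.add_mem ?_ (ZSpan.add_mem
      (mixed_mem y'_injective z'_injective (by simp) hq.y' hq.z' _ _ fun _ _ => yz_mem hq rfl)
      (ZSpan.smul_mem _ (mixed_mem y'_injective z'_injective (by simp)
        hq.y' hq.z' _ _ fun _ _ => y'z'_mem hq rfl)))
    rw [mul_assoc]
    refine lam_X_mul_mem z'_injective
      (fun n => by simp [Derivation.leibniz, hq.z']) j
      (fun m k => y'z'_mem (i := i) (j := m) (hq.pderiv_p k) ?_) (fun m k => y'z'_mem (i := i) (j := m) (hq.p_mul k) ?_)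
      (fun m => y'z'_mem (i := i) (j := m) hq ?_)
    · simp only [Derivation.leibniz, smul_eq_mul]; simp; ring
    all_goals ring

lemma ztplus_mem {f : R} (hf : f ∈ ZSpan) : Ztplus f ∈ ZSpan := by
  refine ZSpan.map_mem isLinearMap_ztplus (fun j q hq => ?_) (fun i j q hq => ?_)
    (fun i j q hq => ?_) hf
  · rw [Ztplus, plus_X_mul z_injective hq.z,
      plus_eq_zero (a := Var.z') fun n => by simp [Derivation.leibniz, hq.z'], add_zero]
    exact z_mem hq rfl
  · rw [Ztplus, plus_eq_zero (a := Var.z') fun n => by simp [Derivation.leibniz, hq.z'],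
      mul_assoc, plus_mul fun n => by simp, plus_X_mul z_injective hq.z, add_zero, ← mul_assoc]
    exact yz_mem hq rfl
  · rw [Ztplus, plus_eq_zero (a := Var.z) fun n => by simp [Derivation.leibniz, hq.z],
      mul_assoc, plus_mul fun n => by simp, plus_X_mul z'_injective hq.z', zero_add, ← mul_assoc]
    exact y'z'_mem hq rfl

lemma ytplus_z_mul {q : R} (hq : IsCoeff q) (j : ℕ) : Ytplus (X (Var.z j) * q) = 0 := by
  rw [Ytplus, plus_eq_zero fun n => by simp [Derivation.leibniz, hq.y],
    plus_eq_zero fun n => by simp [Derivation.leibniz, hq.y'], add_zero]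

lemma ytplus_yz_mul {q : R} (hq : IsCoeff q) (i j : ℕ) :
    Ytplus (X (Var.y i) * X (Var.z j) * q) = X (Var.y (i + 1)) * X (Var.z j) * q := by
  rw [Ytplus, plus_eq_zero (a := Var.y') fun n => by simp [Derivation.leibniz, hq.y'], mul_assoc,
    plus_X_mul y_injective fun n => by simp [Derivation.leibniz, hq.y], add_zero, mul_assoc]

lemma ytplus_y'z'_mul {q : R} (hq : IsCoeff q) (i j : ℕ) :
    Ytplus (X (Var.y' i) * X (Var.z' j) * q) = X (Var.y' (i + 1)) * X (Var.z' j) * q := by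
  rw [Ytplus, plus_eq_zero (a := Var.y) fun n => by simp [Derivation.leibniz, hq.y], mul_assoc,
    plus_X_mul y'_injective fun n => by simp [Derivation.leibniz, hq.y'], zero_add, mul_assoc]

lemma lamYt_z_mul {q : R} (hq : IsCoeff q) (j : ℕ) : LamYt (X (Var.z j) * q) = 0 := by
  rw [LamYt, lam_eq_zero fun n => by simp [Derivation.leibniz, hq.y],
    lam_eq_zero fun n => by simp [Derivation.leibniz, hq.y'], MY_eq_mixed]
  rw [mixed_eq_zero_of_right, mixed_eq_zero_of_right, mixed_eq_zero_of_right]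
  · simp
  all_goals intro n; simp [Derivation.leibniz, hq.y, hq.y']

lemma lamYt_yz_mul {q : R} (hq : IsCoeff q) (i j : ℕ) :
    LamYt (X (Var.y i) * X (Var.z j) * q) = X (Var.z j) * Lam Var.y (X (Var.y i) * q)
      + alpha • Mixed Var.z Var.y Var.z' Var.y' (X (Var.y i) * X (Var.z j) * q) := by
  rw [LamYt, MY_eq_mixed,
    mixed_eq_zero_of_left (u := Var.z') fun n => by simp [Derivation.leibniz, hq.z'],
    mixed_eq_zero_of_left (u := Var.z') fun n => by simp [Derivation.leibniz, hq.z'],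
    lam_eq_zero (a := Var.y') fun n => by simp [Derivation.leibniz, hq.y'],
    mul_right_comm, mul_comm _ (X (Var.z j)),
    lam_mul (a := Var.y) (fun n => by simp) (fun n => by simp)]
  simp

lemma lamYt_y'z'_mul {q : R} (hq : IsCoeff q) (i j : ℕ) :
    LamYt (X (Var.y' i) * X (Var.z' j) * q) = X (Var.z' j) * Lam Var.y' (X (Var.y' i) * q)
      + (Mixed Var.z' Var.y' Var.z Var.y (X (Var.y' i) * X (Var.z' j) * q)
      + bb • Mixed Var.z' Var.y' Var.z' Var.y' (X (Var.y' i) * X (Var.z' j) * q)) := by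
  rw [LamYt, MY_eq_mixed,
    mixed_eq_zero_of_left (u := Var.z) fun n => by simp [Derivation.leibniz, hq.z],
    lam_eq_zero (a := Var.y) fun n => by simp [Derivation.leibniz, hq.y],
    mul_right_comm, mul_comm _ (X (Var.z' j)),
    lam_mul (a := Var.y') (fun n => by simp) (fun n => by simp)]
  simp

lemma lamYt_mem {f : R} (hf : f ∈ ZSpan) : LamYt f ∈ ZSpan := by
  refine ZSpan.map_mem isLinearMap_lamYt (fun j q hq => ?_) (fun i j q hq => ?_)
    (fun i j q hq => ?_) hf
  · rw [lamYt_z_mul hq]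
    exact ZSpan.zero_mem
  · rw [lamYt_yz_mul hq, ← lam_mul (fun n => by simp) (fun n => by simp), mul_left_comm]
    refine ZSpan.add_mem ?_ (ZSpan.smul_mem _ (mixed_mem z_injective y_injective (by simp)
      hq.z hq.y _ _ fun m k => y'z'_mem (i := k) (j := m) hq (by ring)))
    refine lam_X_mul_mem y_injective
      (fun n => by simp [Derivation.leibniz, hq.y]) i
      (fun m k => yz_mem (i := m) (j := j) (hq.pderiv_p k) ?_)
      (fun m k => yz_mem (i := m) (j := j) (hq.p_mul k) ?_)
      (fun m => yz_mem (i := m) (j := j) hq ?_)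
    · simp [Derivation.leibniz, mul_assoc]
    all_goals ring
  · rw [lamYt_y'z'_mul hq, ← lam_mul (fun n => by simp) (fun n => by simp), mul_left_comm]
    refine ZSpan.add_mem ?_ (ZSpan.add_mem
      (mixed_mem z'_injective y'_injective (by simp)
        hq.z' hq.y' _ _ fun m k => yz_mem (i := k) (j := m) hq (by ring))
      (ZSpan.smul_mem _ (mixed_mem z'_injective y'_injective (by simp)
        hq.z' hq.y' _ _ fun m k => y'z'_mem (i := k) (j := m) hq (by ring))))
    refine lam_X_mul_mem y'_injective
      (fun n => by simp [Derivation.leibniz, hq.y']) i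
      (fun m k => y'z'_mem (i := m) (j := j) (hq.pderiv_p k) ?_)
      (fun m k => y'z'_mem (i := m) (j := j) (hq.p_mul k) ?_)
      (fun m => y'z'_mem (i := m) (j := j) hq ?_)
    · simp [Derivation.leibniz, mul_assoc]
    all_goals ring

/-- The image of `z_j` under `ThZt`: the power sum `p_j`, with the convention `p_0 = 1`. -/
def pOne : ℕ → R
  | 0 => 1
  | j + 1 => X (Var.p (j + 1))

lemma pderiv_pOne {v : Var} (hv : ∀ n, v ≠ Var.p n) (j : ℕ) : pderiv v (pOne j) = 0 := by
  cases j with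
  | zero => simp [pOne]
  | succ j => exact pderiv_X_of_ne' (hv _)

lemma thZt_z_mul {g : R} (hz : ∀ n, pderiv (Var.z n) g = 0) (hz' : ∀ n, pderiv (Var.z' n) g = 0)
    (j : ℕ) : ThZt (X (Var.z j) * g) = pOne j * g := by
  have h (k : ℕ) : pderiv (Var.z' k) (X (Var.z j) * g) = 0 := by simp [Derivation.leibniz, hz']
  simp only [ThZt, h, pderiv_X_mul z_injective hz, map_zero, mul_zero, finsum_zero, add_zero]
  cases j with
  | zero => simp [pOne]
  | succ j =>
    simp only [add_left_inj, mul_ite, mul_zero]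
    rw [finsum_ite_eq (fun i => X (Var.p (i + 1)) * g)]
    simp [pOne]

lemma thZt_y'z'_mul {q : R} (hq : IsCoeff q) (i j : ℕ) :
    ThZt (X (Var.y' i) * X (Var.z' j) * q) = X (Var.y (i + j)) * q := by
  have h (k : ℕ) : pderiv (Var.z k) (X (Var.y' i) * X (Var.z' j) * q) = 0 := by
    simp [Derivation.leibniz, hq.z]
  have h' (k : ℕ) : pderiv (Var.z' k) (X (Var.y' i) * X (Var.z' j) * q)
      = if k = j then X (Var.y' i) * q else 0 := by
    rw [mul_right_comm, mul_comm _ (X _), pderiv_X_mul z'_injective fun n => by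
      simp [Derivation.leibniz, hq.z']]
  simp only [ThZt, h, h', apply_ite (pderiv (R := K) _), map_zero,
    pderiv_X_mul y'_injective hq.y', mul_ite, mul_zero, finsum_zero, zero_add]
  have h'' (k : ℕ) : (∑ᶠ l : ℕ, if l = j then if k = i then X (Var.y (k + l)) * q else 0 else 0)
      = if k = i then X (Var.y (k + j)) * q else 0 :=
    finsum_ite_eq (fun l => if k = i then X (Var.y (k + l)) * q else 0) j
  simp only [h'']
  exact finsum_ite_eq (fun k => X (Var.y (k + j)) * q) i

lemma thZt_ytplus {f : R} (hf : f ∈ ZSpan) : ThZt (Ytplus f) = Plus Var.y (ThZt f) := by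
  refine ZSpan.eq_on (isLinearMap_thZt.comp_apply isLinearMap_ytplus)
    ((isLinearMap_plus y_injective).comp_apply isLinearMap_thZt) (fun j q hq => ?_)
    (fun i j q hq => ?_) (fun i j q hq => ?_) hf
  · rw [ytplus_z_mul hq, isLinearMap_thZt.map_zero, thZt_z_mul hq.z hq.z',
      plus_eq_zero fun n => by simp [Derivation.leibniz, pderiv_pOne, hq.y]]
  · rw [ytplus_yz_mul hq, mul_right_comm, mul_comm _ (X (Var.z j)), mul_right_comm _ _ q,
      mul_comm _ (X (Var.z j)),
      thZt_z_mul (fun n => by simp [Derivation.leibniz, hq.z])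
        (fun n => by simp [Derivation.leibniz, hq.z']),
      thZt_z_mul (fun n => by simp [Derivation.leibniz, hq.z])
        (fun n => by simp [Derivation.leibniz, hq.z']),
      plus_mul (fun n => by simp [pderiv_pOne]), plus_X_mul y_injective hq.y]
  · rw [ytplus_y'z'_mul hq, thZt_y'z'_mul hq, thZt_y'z'_mul hq, plus_X_mul y_injective hq.y,
      add_right_comm]

lemma finite_support_lam_term (m : ℕ → ℕ) (a : ℕ → Var) (g q : R) :
    (Function.support fun i : ℕ =>
      ((i + 1 : ℕ) : K) • (X (a (m i)) * (g * pderiv (Var.p (i + 1)) q))).Finite := by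
  obtain ⟨N, hN⟩ := exists_pderiv_eq_zero p_injective q
  exact finite_support_of_eventually_zero ⟨N, fun n hn => by
    rw [hN _ (by omega), mul_zero, mul_zero, smul_zero]⟩

lemma lam_y_X_mul_pOne_mul {q : R} (hq : IsCoeff q) (i j : ℕ) :
    Lam Var.y (X (Var.y i) * (pOne j * q))
      = pOne j * Lam Var.y (X (Var.y i) * q) + alpha • ((j : K) • (X (Var.y (i + j)) * q)) := by
  have hd (k : ℕ) : pderiv (Var.p (k + 1)) (pOne j * q)
      = pOne j * pderiv (Var.p (k + 1)) q + if k + 1 = j then q else 0 := by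
    rw [Derivation.leibniz, smul_eq_mul, smul_eq_mul]
    cases j with
    | zero => simp [pOne]
    | succ j =>
      classical
      simp [pOne, pderiv_X, Pi.single_apply, eq_comm]
  have hs : ∑ᶠ k : ℕ, ((k + 1 : ℕ) : K) •
        (X (Var.y (k + i + 1)) * pderiv (Var.p (k + 1)) (pOne j * q))
      = pOne j * (∑ᶠ k : ℕ, ((k + 1 : ℕ) : K) •
          (X (Var.y (k + i + 1)) * pderiv (Var.p (k + 1)) q))
        + (j : K) • (X (Var.y (i + j)) * q) := by
    simp only [hd, mul_add, smul_add]
    rw [finsum_add_distrib (finite_support_lam_term (fun k => k + i + 1) _ _ _), mul_finsum]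
    · congr 1
      · exact finsum_congr fun k => by rw [mul_smul_comm, mul_left_comm]
      · cases j with
        | zero => simp
        | succ j =>
          simp only [mul_ite, mul_zero, smul_ite, smul_zero, add_left_inj]
          rw [finsum_ite_eq (fun k => ((k + 1 : ℕ) : K) • (X (Var.y (k + i + 1)) * q)),
            show j + i + 1 = i + (j + 1) by omega]
    · exact finite_support_of_eventually_zero ⟨j, fun n hn => by
        rw [if_neg (by omega), mul_zero, smul_zero]⟩
  rw [lam_X_mul y_injective (fun n => by simp [Derivation.leibniz, pderiv_pOne, hq.y]),
    lam_X_mul y_injective hq.y, hs]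
  simp only [mul_add, Finset.mul_sum, mul_smul_comm, smul_add, mul_left_comm (pOne j)]
  abel

lemma map_sum' {T : R → R} (hT : IsLinearMap K T) (s : Finset ℕ) (F : ℕ → R) :
    T (∑ i ∈ s, F i) = ∑ i ∈ s, T (F i) :=
  map_sum (hT.mk' T) F s

lemma map_finsum' {T : R → R} (hT : IsLinearMap K T) {F : ℕ → R}
    (hF : (Function.support F).Finite) : T (∑ᶠ i, F i) = ∑ᶠ i, T (F i) :=
  (hT.mk' T).toAddMonoidHom.map_finsum hF

lemma thZt_lamYt_yz {q : R} (hq : IsCoeff q) (i j : ℕ) :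
    ThZt (LamYt (X (Var.y i) * X (Var.z j) * q))
      = Lam Var.y (ThZt (X (Var.y i) * X (Var.z j) * q)) := by
  have hT := isLinearMap_thZt
  rw [lamYt_yz_mul hq, hT.map_add, hT.map_smul, mixed_X_mul_X_mul z_injective y_injective (by simp)
    hq.z hq.y, map_sum' hT, mul_right_comm, mul_comm _ (X (Var.z j)),
    thZt_z_mul (fun n => pderiv_lam_eq_zero (by simp) (by simp)
        (by simp [Derivation.leibniz, hq.z]))
      (fun n => pderiv_lam_eq_zero (by simp) (by simp) (by simp [Derivation.leibniz, hq.z'])),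
    thZt_z_mul (fun n => by simp [Derivation.leibniz, hq.z])
      (fun n => by simp [Derivation.leibniz, hq.z']),
    mul_left_comm, lam_y_X_mul_pOne_mul hq]
  have h : ∀ k ∈ Finset.range j, ThZt (X (Var.z' (k + i + 1)) * X (Var.y' (j - 1 - k)) * q)
      = X (Var.y (i + j)) * q := fun k hk => by
    have := Finset.mem_range.mp hk
    rw [mul_comm (X _) (X _), thZt_y'z'_mul hq, show j - 1 - k + (k + i + 1) = i + j by omega]
  rw [Finset.sum_congr rfl h, Finset.sum_const, Finset.card_range, Nat.cast_smul_eq_nsmul]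

lemma thZt_lamYt_y'z' {q : R} (hq : IsCoeff q) (i j : ℕ) :
    ThZt (LamYt (X (Var.y' i) * X (Var.z' j) * q))
      = Lam Var.y (ThZt (X (Var.y' i) * X (Var.z' j) * q)) := by
  have hT := isLinearMap_thZt
  have hmul (k : ℕ) {g : R} (hg : IsCoeff g) :
      ThZt (X (Var.z' j) * (X (Var.y' k) * g)) = X (Var.y (k + j)) * g := by
    rw [← mul_assoc, mul_comm (X (Var.z' j)), thZt_y'z'_mul hg]
  have h₁ : ThZt (X (Var.z' j) * ∑ᶠ k : ℕ, ((k + 1 : ℕ) : K) •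
        (X (Var.y' (k + i + 1)) * pderiv (Var.p (k + 1)) q))
      = ∑ᶠ k : ℕ, ((k + 1 : ℕ) : K) •
        (X (Var.y (k + (i + j) + 1)) * pderiv (Var.p (k + 1)) q) := by
    simp only [mul_finsum, mul_smul_comm, mul_left_comm (X (Var.z' j))]
    rw [map_finsum' hT (finite_support_lam_term (fun k => k + i + 1) _ _ _)]
    refine finsum_congr fun k => ?_
    rw [hT.map_smul, mul_left_comm, hmul _ (hq.pderiv_p _),
      show k + i + 1 + j = k + (i + j) + 1 by omega]
  have h₂ : ThZt (X (Var.z' j) * ∑ k ∈ Finset.range i,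
        X (Var.y' (i - 1 - k)) * X (Var.p (k + 1)) * q)
      = ∑ k ∈ Finset.range i, X (Var.y (i + j - 1 - k)) * X (Var.p (k + 1)) * q := by
    rw [Finset.mul_sum, map_sum' hT]
    refine Finset.sum_congr rfl fun k hk => ?_
    have := Finset.mem_range.mp hk
    rw [mul_assoc, hmul _ (hq.p_mul _), show i - 1 - k + j = i + j - 1 - k by omega, mul_assoc]
  have h₃ : ∑ k ∈ Finset.range j, ThZt (X (Var.z (k + i + 1)) * X (Var.y (j - 1 - k)) * q)
      = ∑ k ∈ Finset.range j,
        X (Var.y (i + j - 1 - (i + k))) * X (Var.p (i + k + 1)) * q := by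
    refine Finset.sum_congr rfl fun k hk => ?_
    rw [mul_assoc, thZt_z_mul (fun n => by simp [Derivation.leibniz, hq.z])
      (fun n => by simp [Derivation.leibniz, hq.z']),
      show i + j - 1 - (i + k) = j - 1 - k by omega, add_comm k i, pOne]
    ring
  have h₄ : ∑ k ∈ Finset.range j, ThZt (X (Var.z' (k + i + 1)) * X (Var.y' (j - 1 - k)) * q)
      = (j : K) • (X (Var.y (i + j)) * q) := by
    have h : ∀ k ∈ Finset.range j, ThZt (X (Var.z' (k + i + 1)) * X (Var.y' (j - 1 - k)) * q)
        = X (Var.y (i + j)) * q := fun k hk => by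
      have := Finset.mem_range.mp hk
      rw [mul_comm (X _) (X _), thZt_y'z'_mul hq, show j - 1 - k + (k + i + 1) = i + j by omega]
    rw [Finset.sum_congr rfl h, Finset.sum_const, Finset.card_range, Nat.cast_smul_eq_nsmul]
  rw [lamYt_y'z'_mul hq, thZt_y'z'_mul hq, lam_X_mul y_injective hq.y, lam_X_mul y'_injective hq.y',
    mixed_X_mul_X_mul z'_injective y'_injective (by simp) hq.z' hq.y',
    mixed_X_mul_X_mul z'_injective y'_injective (by simp) hq.z' hq.y']
  simp only [mul_add, mul_smul_comm, hT.map_add, hT.map_smul, h₁, h₂, map_sum' hT, h₃, h₄,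
    hmul i hq, Finset.sum_range_add, Nat.cast_add i j, add_smul (i : K) (j : K), smul_add]
  abel

lemma thZt_lamYt {f : R} (hf : f ∈ ZSpan) : ThZt (LamYt f) = Lam Var.y (ThZt f) := by
  refine ZSpan.eq_on (isLinearMap_thZt.comp_apply isLinearMap_lamYt)
    ((isLinearMap_lam y_injective).comp_apply isLinearMap_thZt) (fun j q hq => ?_)
    (fun i j q hq => thZt_lamYt_yz hq i j) (fun i j q hq => thZt_lamYt_y'z' hq i j) hf
  rw [lamYt_z_mul hq, isLinearMap_thZt.map_zero, thZt_z_mul hq.z hq.z',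
    lam_eq_zero fun n => by simp [Derivation.leibniz, pderiv_pOne, hq.y]]

lemma iterate_lamYt_mem {f : R} (hf : f ∈ ZSpan) (n : ℕ) : LamYt^[n] f ∈ ZSpan := by
  induction n with
  | zero => exact hf
  | succ n ih => rw [Function.iterate_succ_apply']; exact lamYt_mem ih

lemma ZL_mem {f : R} (hf : f ∈ ZSpan) (m : ℕ) : ZL m f ∈ ZSpan := by
  refine ztplus_mem ?_
  induction m with
  | zero => exact hf
  | succ m ih => rw [Function.iterate_succ_apply']; exact lamZt_mem ih

lemma thZt_YL {f : R} (hf : f ∈ ZSpan) (n : ℕ) : ThZt (YL n f) = YLplain n (ThZt f) := by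
  rw [YL, YLplain, thZt_ytplus (iterate_lamYt_mem hf n)]
  congr 1
  induction n with
  | zero => rfl
  | succ n ih =>
    rw [Function.iterate_succ_apply', Function.iterate_succ_apply',
      thZt_lamYt (iterate_lamYt_mem hf n), ih]

/-- A polynomial annihilated by all derivatives in the `y'`, `z`, `z'` variables. -/
structure IsYCoeff (f : R) : Prop where
  y' : ∀ n, pderiv (Var.y' n) f = 0
  z : ∀ n, pderiv (Var.z n) f = 0
  z' : ∀ n, pderiv (Var.z' n) f = 0

lemma IsYCoeff.lam {f : R} (hf : IsYCoeff f) : IsYCoeff (Lam Var.y f) where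
  y' n := pderiv_lam_eq_zero (by simp) (by simp) (hf.y' n)
  z n := pderiv_lam_eq_zero (by simp) (by simp) (hf.z n)
  z' n := pderiv_lam_eq_zero (by simp) (by simp) (hf.z' n)

lemma IsYCoeff.of_mem_PY {f : R} (hf : f ∈ PY) : IsYCoeff f := by
  induction hf using Submodule.span_induction with
  | mem g hg =>
    rcases hg with hg | ⟨i, q, hq, rfl⟩
    · have hq := IsCoeff.of_mem_psub hg
      exact ⟨hq.y', hq.z, hq.z'⟩
    · have hq := IsCoeff.of_mem_psub hq
      constructor <;> intro n <;> simp [Derivation.leibniz, hq.y', hq.z, hq.z']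
  | zero => constructor <;> simp
  | add f g _ _ hf hg =>
    constructor <;> intro n <;> simp [hf.y', hf.z, hf.z', hg.y', hg.z, hg.z']
  | smul c f _ hf => constructor <;> intro n <;> simp [hf.y', hf.z, hf.z']

lemma z_zero_mul_mem {f : R} (hf : f ∈ PY) : X (Var.z 0) * f ∈ ZSpan := by
  induction hf using Submodule.span_induction with
  | mem g hg =>
    rcases hg with hg | ⟨i, q, hq, rfl⟩
    · exact z_mem (.of_mem_psub hg) rfl
    · exact yz_mem (i := i) (j := 0) (.of_mem_psub hq) (by ring)
  | zero => rw [mul_zero]; exact ZSpan.zero_mem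
  | add f g _ _ hf hg => rw [mul_add]; exact ZSpan.add_mem hf hg
  | smul c f _ hf => rw [mul_smul_comm]; exact ZSpan.smul_mem c hf

lemma lamYt_z_zero_mul {f : R} (hf : IsYCoeff f) :
    LamYt (X (Var.z 0) * f) = X (Var.z 0) * Lam Var.y f := by
  rw [LamYt, lam_mul (fun n => by simp) (fun n => by simp),
    lam_eq_zero (a := Var.y') fun n => by simp [Derivation.leibniz, hf.y'], MY_eq_mixed]
  rw [mixed_eq_zero_of_left, mixed_eq_zero_of_left, mixed_eq_zero_of_left]
  · simp
  all_goals intro n; simp [Derivation.leibniz, hf.z, hf.z']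

lemma ytplus_z_zero_mul {f : R} (hf : IsYCoeff f) :
    Ytplus (X (Var.z 0) * f) = X (Var.z 0) * Plus Var.y f := by
  rw [Ytplus, plus_mul (fun n => by simp),
    plus_eq_zero (a := Var.y') fun n => by simp [Derivation.leibniz, hf.y'], add_zero]

lemma YL_z_zero_mul {f : R} (hf : IsYCoeff f) (n : ℕ) :
    YL n (X (Var.z 0) * f) = X (Var.z 0) * YLplain n f := by
  induction n generalizing f with
  | zero => exact ytplus_z_zero_mul hf
  | succ n ih =>
    have h := ih hf.lam
    rw [YL, YLplain] at h ⊢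
    rw [Function.iterate_succ_apply, Function.iterate_succ_apply, lamYt_z_zero_mul hf, h]

/-- **Half relation** (equation (4.13) of Chapuy–Dołęga): for all `m, n ≥ 0`,
`Θ_Z̃ ∘ [Z̃_+Λ_Z̃^{m+1}, Ỹ_+Λ_Ỹ^{n}] ∘ (z₀·) = [Θ_Z̃ Z̃_+Λ_Z̃^{m+1} (z₀·), Y_+Λ_Y^{n}]`
on `𝒫_Y`. -/
theorem half_relation (m n : ℕ) :
    ∀ f ∈ PY,
      ThZt (ZL (m + 1) (YL n (X (Var.z 0) * f)) - YL n (ZL (m + 1) (X (Var.z 0) * f)))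
        = ThZt (ZL (m + 1) (X (Var.z 0) * YLplain n f))
          - YLplain n (ThZt (ZL (m + 1) (X (Var.z 0) * f))) := by
  intro f hf
  rw [isLinearMap_thZt.map_sub, thZt_YL (ZL_mem (z_zero_mul_mem hf) _),
    YL_z_zero_mul (IsYCoeff.of_mem_PY hf)]
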